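/- Let k ≥ 2, and let a ≤ b ≤ c ≤ d be four elements of the starting configuration S = {a, b, c, d, x₁, …, x_m}. Let T be the configuration obtained from S by performing the moves (a,b) and (c,d), let U be the configuration obtained by performing the moves (a,c) and (b,d), and let V be the configuration obtained by performing the moves (a,d) and (b,c). If opt(U, k−2) = opt(S,k) or opt(V, k−2) = opt(S,k), then opt(T, k−2) = opt(S,k). -/

import Mathlib

/-- One move of the game: choose two elements `a` and `b` of the current configuration
(counted with multiplicity) and replace both of them by `a + b`. -/
def GameMove (S T : Multiset ℕ) : Prop :=
  ∃ (a b : ℕ) (S' : Multiset ℕ),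
    S = a ::ₘ b ::ₘ S' ∧ T = (a + b) ::ₘ (a + b) ::ₘ S'

/-- `ReachIn k S T` means the configuration `T` can be obtained from `S` by exactly
`k` moves of the game. -/
def ReachIn : ℕ → Multiset ℕ → Multiset ℕ → Prop
  | 0 => fun S T => T = S
  | k + 1 => fun S T => ∃ U : Multiset ℕ, GameMove S U ∧ ReachIn k U T

/-- `opt S k` is the smallest possible sum of a configuration obtainable from the
starting configuration `S` after exactly `k` moves. -/
noncomputable def opt (S : Multiset ℕ) (k : ℕ) : ℕ :=
  sInf {s : ℕ | ∃ T : Multiset ℕ, ReachIn k S T ∧ T.sum = s}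

/-- A play from `L.map φ` lifts to a play whose configurations are images of multisets in `A`, and
the lifted play can be carried out under any other additive map `ψ`. -/
theorem ReachIn.exists_lift {A : Type*} [AddCommMonoid A] (φ : A →+ ℕ) (k : ℕ) :
    ∀ (L : Multiset A) (T : Multiset ℕ), ReachIn k (L.map φ) T →
      ∃ L' : Multiset A, T = L'.map φ ∧ ∀ ψ : A →+ ℕ, ReachIn k (L.map ψ) (L'.map ψ) := by
  classical
  induction k with
  | zero => exact fun L T h => ⟨L, h, fun _ => rfl⟩
  | succ k ih =>
    rintro L T ⟨U, ⟨a, b, S', hS, rfl⟩, hT⟩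
    obtain ⟨u, hu, rfl, h⟩ := (Multiset.map_eq_cons φ L _ a).2 hS
    obtain ⟨v, hv, rfl, rfl⟩ := (Multiset.map_eq_cons φ _ _ b).2 h
    obtain ⟨L', rfl, h'⟩ := ih ((u + v) ::ₘ (u + v) ::ₘ (L.erase u).erase v) T (by simpa using hT)
    refine ⟨L', rfl, fun ψ => ⟨_, ⟨ψ u, ψ v, ((L.erase u).erase v).map ψ, ?_, rfl⟩, ?_⟩⟩
    · rw [← Multiset.map_cons, ← Multiset.map_cons, Multiset.cons_erase hv, Multiset.cons_erase hu]
    · simpa using h' ψ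

theorem exists_reachIn (k : ℕ) :
    ∀ S : Multiset ℕ, 2 ≤ S.card → ∃ T, ReachIn k S T := by
  induction k with
  | zero => exact fun S _ => ⟨S, rfl⟩
  | succ k ih =>
    intro S hS
    obtain ⟨a, S, rfl⟩ := Multiset.exists_mem_of_ne_zero
      (Multiset.card_pos.1 (by omega : 0 < S.card)) |>.imp fun _ => Multiset.exists_cons_of_mem
    rw [Multiset.card_cons] at hS
    obtain ⟨b, S, rfl⟩ := Multiset.exists_mem_of_ne_zero
      (Multiset.card_pos.1 (by omega : 0 < S.card)) |>.imp fun _ => Multiset.exists_cons_of_mem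
    obtain ⟨T, hT⟩ := ih ((a + b) ::ₘ (a + b) ::ₘ S) (by simp)
    exact ⟨T, _, ⟨a, b, S, rfl, rfl⟩, hT⟩

theorem opt_le_of_reachIn {S T : Multiset ℕ} {k : ℕ} (h : ReachIn k S T) : opt S k ≤ T.sum :=
  Nat.sInf_le ⟨T, h, rfl⟩

theorem exists_reachIn_sum_eq_opt {S : Multiset ℕ} (k : ℕ) (hS : 2 ≤ S.card) :
    ∃ T, ReachIn k S T ∧ T.sum = opt S k := by
  obtain ⟨T, hT⟩ := exists_reachIn k S hS
  exact Nat.sInf_mem (s := {s | ∃ T, ReachIn k S T ∧ T.sum = s}) ⟨_, T, hT, rfl⟩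

theorem opt_succ_le_of_gameMove {S T : Multiset ℕ} (k : ℕ) (h : GameMove S T) :
    opt S (k + 1) ≤ opt T k := by
  obtain ⟨a, b, S', -, rfl⟩ := id h
  obtain ⟨R, hR, hsum⟩ := exists_reachIn_sum_eq_opt k
    (S := (a + b) ::ₘ (a + b) ::ₘ S') (by simp)
  exact hsum ▸ opt_le_of_reachIn ⟨_, h, hR⟩

/-- The additive map `(x, y, z) ↦ p * x + q * y + z`. -/
def affineEval (p q : ℕ) : ℕ × ℕ × ℕ →+ ℕ where
  toFun t := p * t.1 + q * t.2.1 + t.2.2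
  map_zero' := by simp
  map_add' s t := by simp only [Prod.fst_add, Prod.snd_add]; ring

/-- Schur concavity of `opt` for a single pair: spreading two elements apart while keeping their
sum does not increase the optimum. -/
theorem opt_le_opt_of_spread {p q p' q' : ℕ} (k : ℕ) (Y : Multiset ℕ) (hp : p ≤ p') (hq : p ≤ q')
    (hsum : p + q = p' + q') : opt (p ::ₘ q ::ₘ Y) k ≤ opt (p' ::ₘ q' ::ₘ Y) k := by
  obtain ⟨T, hT, hTsum⟩ := exists_reachIn_sum_eq_opt k (S := p' ::ₘ q' ::ₘ Y) (by simp)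
  have key (r s : ℕ) : (((1, 0, 0) : ℕ × ℕ × ℕ) ::ₘ (0, 1, 0) ::ₘ
      Y.map fun y => ((0, 0, y) : ℕ × ℕ × ℕ)).map (affineEval r s) = r ::ₘ s ::ₘ Y := by
    simp [affineEval]
  rw [← key] at hT
  obtain ⟨L, rfl, hL⟩ := ReachIn.exists_lift _ k _ _ hT
  have h₁ := opt_le_of_reachIn (hL (affineEval p q))
  have h₂ := opt_le_of_reachIn (hL (affineEval q p))
  rw [key, ← map_multiset_sum] at h₁ h₂
  rw [Multiset.cons_swap] at h₂
  rw [← hTsum, ← map_multiset_sum]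
  generalize L.sum = t at h₁ h₂
  obtain ⟨x, y, z⟩ := t
  simp only [affineEval, AddMonoidHom.coe_mk, ZeroHom.coe_mk] at h₁ h₂ ⊢
  rcases le_total y x with hxy | hxy
  · refine h₁.trans ?_
    zify at *
    nlinarith [mul_nonneg (sub_nonneg.2 hp) (sub_nonneg.2 hxy)]
  · refine h₂.trans ?_
    zify at *
    nlinarith [mul_nonneg (sub_nonneg.2 hq) (sub_nonneg.2 hxy)]

/-- Spreading two doubled elements apart does not increase the optimum. -/
theorem opt_le_opt_of_spread_double {p q p' q' : ℕ} (k : ℕ) (Y : Multiset ℕ) (hp : p ≤ p')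
    (hq : p ≤ q') (hsum : p + q = p' + q') :
    opt (p ::ₘ p ::ₘ q ::ₘ q ::ₘ Y) k ≤ opt (p' ::ₘ p' ::ₘ q' ::ₘ q' ::ₘ Y) k := by
  have swap (x y u v : ℕ) : x ::ₘ y ::ₘ u ::ₘ v ::ₘ Y = x ::ₘ u ::ₘ y ::ₘ v ::ₘ Y := by
    rw [Multiset.cons_swap y u]
  have swap' (x y u v : ℕ) : x ::ₘ y ::ₘ u ::ₘ v ::ₘ Y = u ::ₘ v ::ₘ x ::ₘ y ::ₘ Y := by
    simp only [← Multiset.singleton_add]; abel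
  rw [swap p p, swap p' p']
  refine (opt_le_opt_of_spread k _ hp hq hsum).trans ?_
  rw [swap' p' q' p q, swap' p' q' p' q']
  exact opt_le_opt_of_spread k _ hp hq hsum

/-- Let `k ≥ 2` and let `a ≤ b ≤ c ≤ d` be four elements of the starting configuration
`S = {a, b, c, d, x₁, …, x_m}` (all positive).  Let `T`, `U`, `V` be the configurations
obtained from `S` by performing the pairs of moves `(a,b), (c,d)`, resp. `(a,c), (b,d)`,
resp. `(a,d), (b,c)`.  If starting with the moves leading to `U` or to `V` is optimal,
then so is starting with the moves leading to `T`. -/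
theorem optimal_first_two_moves_pairing (k : ℕ) (hk : 2 ≤ k)
    (a b c d : ℕ) (X : Multiset ℕ)
    (ha : 0 < a) (hab : a ≤ b) (hbc : b ≤ c) (hcd : c ≤ d) (hX : ∀ x ∈ X, 0 < x)
    (h : opt ((a + c) ::ₘ (a + c) ::ₘ (b + d) ::ₘ (b + d) ::ₘ X) (k - 2)
            = opt (a ::ₘ b ::ₘ c ::ₘ d ::ₘ X) k ∨
         opt ((a + d) ::ₘ (a + d) ::ₘ (b + c) ::ₘ (b + c) ::ₘ X) (k - 2)
            = opt (a ::ₘ b ::ₘ c ::ₘ d ::ₘ X) k) :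
    opt ((a + b) ::ₘ (a + b) ::ₘ (c + d) ::ₘ (c + d) ::ₘ X) (k - 2)
        = opt (a ::ₘ b ::ₘ c ::ₘ d ::ₘ X) k := by
  obtain ⟨j, rfl⟩ := Nat.exists_eq_add_of_le' hk
  rw [Nat.add_sub_cancel] at h ⊢
  apply le_antisymm
  · rcases h with h | h <;> rw [← h] <;>
      exact opt_le_opt_of_spread_double j X (by omega) (by omega) (by omega)
  · have h₁ : GameMove (a ::ₘ b ::ₘ c ::ₘ d ::ₘ X)
        ((a + b) ::ₘ (a + b) ::ₘ c ::ₘ d ::ₘ X) := ⟨a, b, _, rfl, rfl⟩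
    have h₂ : GameMove ((a + b) ::ₘ (a + b) ::ₘ c ::ₘ d ::ₘ X)
        ((a + b) ::ₘ (a + b) ::ₘ (c + d) ::ₘ (c + d) ::ₘ X) :=
      ⟨c, d, (a + b) ::ₘ (a + b) ::ₘ X, by simp only [← Multiset.singleton_add]; abel,
        by simp only [← Multiset.singleton_add]; abel⟩
    exact (opt_succ_le_of_gameMove (j + 1) h₁).trans (opt_succ_le_of_gameMove j h₂)
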